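/- For every natural number n and every positive integer m, the sum over all tuples (y₁, …, yₙ) of nonnegative integers satisfying Σᵢ₌₁ⁿ i·yᵢ = n of ( (Σᵢ yᵢ)! / (y₁! ⋯ yₙ!) ) · (−1)^{Σᵢ yᵢ} · Πᵢ₌₁ⁿ (binom(i + m − 1, m − 1))^{yᵢ}, computed in ℤ, equals (−1)ⁿ · binom(m, n). -/

import Mathlib

open Finset

lemma aux_coeff_pow (n k : ℕ) (a : Fin n → ℤ) :
    PowerSeries.coeff n ((∑ i : Fin n, PowerSeries.C (-a i) * PowerSeries.X ^ ((i : ℕ) + 1)) ^ k) =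
    ∑ y ∈ (Finset.piAntidiag (univ : Finset (Fin n)) k).filter
        (fun y => ∑ i : Fin n, ((i : ℕ) + 1) * y i = n),
      (Nat.multinomial Finset.univ y : ℤ) * (-1) ^ (∑ i, y i) * ∏ i : Fin n, a i ^ y i := by
  rw [Finset.sum_pow_eq_sum_piAntidiag, map_sum, Finset.sum_filter]
  refine Finset.sum_congr rfl fun y _ => ?_
  have h : ∏ i : Fin n, (PowerSeries.C (-a i) * PowerSeries.X ^ ((i : ℕ) + 1)) ^ y i
      = PowerSeries.C ((-1) ^ (∑ i, y i) * ∏ i : Fin n, a i ^ y i) *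
        PowerSeries.X ^ (∑ i : Fin n, ((i : ℕ) + 1) * y i) := by
    simp_rw [mul_pow, Finset.prod_mul_distrib, ← pow_mul, Finset.prod_pow_eq_pow_sum, ← map_pow,
      ← map_prod, neg_pow (a _), Finset.prod_mul_distrib, Finset.prod_pow_eq_pow_sum]
  rw [h, ← map_natCast (PowerSeries.C (R := ℤ)), ← mul_assoc, ← map_mul,
    PowerSeries.coeff_C_mul, PowerSeries.coeff_X_pow]
  by_cases hy : ∑ i : Fin n, ((i : ℕ) + 1) * y i = n
  · simp [hy, mul_assoc]
  · rw [if_neg (Ne.symm hy), if_neg hy, mul_zero]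

lemma aux_one_sub (m n : ℕ) :
    PowerSeries.coeff n ((1 - PowerSeries.X : PowerSeries ℤ) ^ m) = (-1) ^ n * (m.choose n : ℤ) := by
  have h : (1 - PowerSeries.X : PowerSeries ℤ) ^ m =
      ∑ k ∈ range (m + 1), PowerSeries.C ((-1) ^ k * (m.choose k : ℤ)) * PowerSeries.X ^ k := by
    rw [sub_eq_neg_add, add_pow]
    refine Finset.sum_congr rfl fun k _ => ?_
    rw [neg_pow]
    simp
    ring
  rw [h, map_sum]
  simp only [PowerSeries.coeff_C_mul, PowerSeries.coeff_X_pow]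
  simp only [mul_ite, mul_one, mul_zero, Finset.sum_ite_eq, Finset.mem_range]
  split_ifs with h
  · rfl
  · rw [Nat.choose_eq_zero_of_lt (by omega)]; simp

theorem partition_multinomial_choose_neg_sum (n m : ℕ) (hm : 1 ≤ m) :
    ∑ y ∈ (Fintype.piFinset fun _ : Fin n => Finset.range (n + 1)).filter
        (fun y => ∑ i : Fin n, ((i : ℕ) + 1) * y i = n),
      (Nat.multinomial Finset.univ y : ℤ) * (-1) ^ (∑ i, y i) *
        ∏ i : Fin n, (((((i : ℕ) + 1) + m - 1).choose (m - 1) : ℤ)) ^ y i =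
      (-1) ^ n * (m.choose n : ℤ) := by
  obtain ⟨d, rfl⟩ : ∃ d, m = d + 1 := ⟨m - 1, by omega⟩
  set a : Fin n → ℤ := fun i => ((((i : ℕ) + 1) + (d + 1) - 1).choose (d + 1 - 1) : ℤ) with ha
  set N : PowerSeries ℤ := ∑ i : Fin n, PowerSeries.C (-a i) * PowerSeries.X ^ ((i : ℕ) + 1) with hN
  have hw : ∀ y : Fin n → ℕ, ∑ i : Fin n, ((i : ℕ) + 1) * y i = n → ∑ i, y i ≤ n := by
    intro y hy
    calc ∑ i, y i ≤ ∑ i : Fin n, ((i : ℕ) + 1) * y i :=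
          Finset.sum_le_sum fun i _ => Nat.le_mul_of_pos_left _ (by omega)
      _ = n := hy
  have h1 : ∑ y ∈ (Fintype.piFinset fun _ : Fin n => Finset.range (n + 1)).filter
        (fun y => ∑ i : Fin n, ((i : ℕ) + 1) * y i = n),
      (Nat.multinomial Finset.univ y : ℤ) * (-1) ^ (∑ i, y i) * ∏ i : Fin n, a i ^ y i =
      PowerSeries.coeff n (∑ k ∈ range (n + 1), N ^ k) := by
    rw [map_sum, ← Finset.sum_fiberwise_of_maps_to (t := range (n + 1)) (g := fun y => ∑ i, y i)]
    · refine Finset.sum_congr rfl fun k hk => ?_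
      rw [hN, aux_coeff_pow]
      refine Finset.sum_congr ?_ fun _ _ => rfl
      ext y
      simp only [Finset.mem_filter, Fintype.mem_piFinset, Finset.mem_range, Finset.mem_piAntidiag]
      constructor
      · rintro ⟨⟨_, h⟩, h'⟩
        exact ⟨⟨h', by simp⟩, h⟩
      · rintro ⟨⟨h', _⟩, h⟩
        refine ⟨⟨fun i => ?_, h⟩, h'⟩
        have := hw y h
        have h2 := Finset.single_le_sum (f := y) (fun _ _ => Nat.zero_le _) (Finset.mem_univ i)
        omega
    · intro y hy
      have := hw y (Finset.mem_filter.1 hy).2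
      exact Finset.mem_range.2 (by omega)
  rw [h1]
  have hXN : PowerSeries.X ∣ N := by
    refine Finset.dvd_sum fun i _ => ?_
    exact Dvd.dvd.mul_left (dvd_pow_self _ (by omega)) _
  obtain ⟨Q, hQ⟩ := pow_dvd_pow_of_dvd hXN (n + 1)
  set F : PowerSeries ℤ := PowerSeries.mk fun k => ((d + k).choose d : ℤ) with hF
  have hinv : F * (1 - PowerSeries.X) ^ (d + 1) = 1 := by
    have := (PowerSeries.invOneSubPow ℤ (d + 1)).val_inv
    rw [PowerSeries.invOneSubPow_inv_eq_one_sub_pow] at this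
    rw [PowerSeries.invOneSubPow_val_succ_eq_mk_add_choose] at this
    exact this
  have hR : PowerSeries.X ^ (n + 1) ∣ F - (1 - N) := by
    rw [PowerSeries.X_pow_dvd_iff]
    intro j hj
    rw [map_sub, map_sub, hN, map_sum]
    simp only [PowerSeries.coeff_C_mul, PowerSeries.coeff_X_pow, hF, PowerSeries.coeff_mk,
      PowerSeries.coeff_one]
    rcases j with _ | j
    · simp
    · rw [Finset.sum_eq_single (⟨j, by omega⟩ : Fin n)]
      · simp only [ha]
        have : j + 1 + (d + 1) - 1 = d + (j + 1) := by omega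
        simp [this]
      · intro b _ hb
        have : ¬ (j + 1 = (b : ℕ) + 1) := fun h => hb (Fin.ext (by simp; omega))
        rw [if_neg this, mul_zero]
      · simp
  obtain ⟨R, hR⟩ := hR
  have hg := geom_sum_mul_neg N (n + 1)
  have hS : ∑ k ∈ range (n + 1), N ^ k = (1 - PowerSeries.X) ^ (d + 1) + PowerSeries.X ^ (n + 1) *
      ((1 - PowerSeries.X) ^ (d + 1) * ((∑ k ∈ range (n + 1), N ^ k) * R - Q)) := by
    generalize ∑ k ∈ range (n + 1), N ^ k = S at *
    rw [hQ] at hg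
    linear_combination (-S) * hinv + (1 - PowerSeries.X) ^ (d + 1) * hg +
      (1 - PowerSeries.X) ^ (d + 1) * S * hR
  rw [hS, map_add, aux_one_sub, PowerSeries.coeff_X_pow_mul', if_neg (by omega), add_zero]
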